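/- arXiv:2401.00636 — 2 statements merged into one kernel-verified Lean document; each statement's English description precedes it below -/
import Mathlib

section
/- Let g, h : ℂ → ℂ be entire functions with h not identically zero, such that there exists C > 0 with |g(s)| = O(e^{C|s|}) and |h(s)| = O(e^{C|s|}) as |s| → ∞. If the meromorphic function g/h is periodic with period 1 (i.e., g(s+1)h(s) = g(s)h(s+1) for all s), then there exists a rational function f : ℂ → ℂ such that g(s)/h(s) = f(e^{2πis}) wherever h(s) ≠ 0. -/
open Complex

lemma aux_blaschke {ι : Type*} (a : ι → ℂ) (ha : Function.Injective a) (R : ℝ) (hR : 0 < R)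
    (S : Finset ι) : ∀ (f : ℂ → ℂ), Differentiable ℂ f → ∀ (m : ℝ),
      (∀ z, ‖z‖ = R → ‖f z‖ ≤ m) → (∀ i ∈ S, ‖a i‖ < R) → (∀ i ∈ S, f (a i) = 0) →
      ‖f 0‖ ≤ m * ∏ i ∈ S, (‖a i‖ / R) := by
  classical
  induction S using Finset.induction_on with
  | empty =>
    intro f hf m hm _ _
    simp only [Finset.prod_empty, mul_one]
    refine Complex.norm_le_of_forall_mem_frontier_norm_le (U := Metric.ball 0 R)
      Metric.isBounded_ball hf.diffContOnCl ?_ ?_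
    · intro z hz
      rw [frontier_ball _ hR.ne'] at hz
      exact hm z (by simpa using hz)
    · exact subset_closure (by simpa using hR)
  | insert i S hi ih =>
    intro f hf m hm haR hz
    have hm0 : 0 ≤ m := (norm_nonneg _).trans (hm (R : ℂ) (by simp [abs_of_pos hR]))
    have hai : ‖a i‖ < R := haR i (Finset.mem_insert_self _ _)
    have hfi : f (a i) = 0 := hz i (Finset.mem_insert_self _ _)
    by_cases h0 : a i = 0
    · rw [← h0, hfi, norm_zero]
      exact mul_nonneg hm0 (Finset.prod_nonneg fun j _ => by positivity)
    have hds : ∀ b, b ≠ a i → dslope f (a i) b = f b / (b - a i) := by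
      intro b hb
      rw [dslope_of_ne _ hb, slope_def_field, hfi, sub_zero]
    have hdd : Differentiable ℂ (dslope f (a i)) := by
      rw [← differentiableOn_univ]
      exact (Complex.differentiableOn_dslope Filter.univ_mem).2 hf.differentiableOn
    have hRc : (R : ℂ) ≠ 0 := by exact_mod_cast hR.ne'
    have key := ih (fun z => dslope f (a i) z * (((R : ℂ) ^ 2 - (starRingEnd ℂ) (a i) * z) / R))
      (hdd.mul (by fun_prop)) m ?_ (fun j hj => haR j (Finset.mem_insert_of_mem hj)) ?_
    · rw [Finset.prod_insert hi]
      rw [hds 0 (Ne.symm h0)] at key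
      have hpos : 0 < ‖a i‖ := norm_pos_iff.2 h0
      have e : ‖f 0 / (0 - a i) * (((R : ℂ) ^ 2 - (starRingEnd ℂ) (a i) * 0) / R)‖
          = ‖f 0‖ / (‖a i‖ / R) := by
        simp only [mul_zero, sub_zero, zero_sub, norm_mul, norm_div, norm_neg, norm_pow,
          Complex.norm_real, Real.norm_eq_abs, abs_of_pos hR]
        field_simp
      rw [e, div_le_iff₀ (by positivity)] at key
      linarith
    · intro z hzR
      have hne : z ≠ a i := by rintro rfl; linarith
      rw [hds z hne]
      have e1 : (R : ℂ) ^ 2 - (starRingEnd ℂ) (a i) * z = z * (starRingEnd ℂ) (z - a i) := by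
        have : z * (starRingEnd ℂ) z = (R : ℂ) ^ 2 := by
          rw [Complex.mul_conj, Complex.normSq_eq_norm_sq, hzR]; push_cast; rfl
        rw [map_sub, mul_sub, this]; ring
      have e2 : ‖f z / (z - a i) * (((R : ℂ) ^ 2 - (starRingEnd ℂ) (a i) * z) / R)‖ = ‖f z‖ := by
        rw [e1]
        have : ‖z - a i‖ ≠ 0 := norm_ne_zero_iff.2 (sub_ne_zero.2 hne)
        simp only [norm_mul, norm_div, Complex.norm_real, Real.norm_eq_abs, abs_of_pos hR,
          RCLike.norm_conj, hzR]
        field_simp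
      rw [e2]; exact hm z hzR
    · intro j hj
      have hne : a j ≠ a i := fun h => hi (ha h ▸ hj)
      simp only [hds _ hne, hz j (Finset.mem_insert_of_mem hj), zero_div, zero_mul]

lemma aux_fact (n : ℕ) (hn : 0 < n) :
    (n.factorial : ℝ) ≤ Real.exp 1 * n * (n ^ n * Real.exp (-n)) := by
  obtain ⟨k, rfl⟩ : ∃ k, n = k + 1 := ⟨n - 1, by omega⟩
  have h := Stirling.stirlingSeq'_antitone (Nat.zero_le k)
  simp only [Function.comp, Nat.succ_eq_add_one, zero_add, Stirling.stirlingSeq_one] at h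
  unfold Stirling.stirlingSeq at h
  rw [div_le_iff₀ (by positivity)] at h
  refine h.trans ?_
  have h1 : √(2 * ((k + 1 : ℕ) : ℝ)) = √2 * √((k + 1 : ℕ) : ℝ) := Real.sqrt_mul (by norm_num) _
  have h2 : √((k + 1 : ℕ) : ℝ) ≤ ((k + 1 : ℕ) : ℝ) := by
    rw [Real.sqrt_le_left (by positivity)]
    have : (1 : ℝ) ≤ ((k + 1 : ℕ) : ℝ) := by exact_mod_cast Nat.succ_le_succ (Nat.zero_le k)
    nlinarith
  have h3 : (((k + 1 : ℕ) : ℝ) / Real.exp 1) ^ (k + 1)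
      = ((k + 1 : ℕ) : ℝ) ^ (k + 1) * Real.exp (-((k + 1 : ℕ) : ℝ)) := by
    rw [div_pow, Real.exp_neg, ← Real.exp_nat_mul, mul_one]; rfl
  rw [h1, h3]
  calc Real.exp 1 / √2 * (√2 * √((k + 1 : ℕ) : ℝ) * (((k + 1 : ℕ) : ℝ) ^ (k + 1) * Real.exp (-((k + 1 : ℕ) : ℝ))))
      = Real.exp 1 * √((k + 1 : ℕ) : ℝ) * (((k + 1 : ℕ) : ℝ) ^ (k + 1) * Real.exp (-((k + 1 : ℕ) : ℝ))) := by
        field_simp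
    _ ≤ _ := by gcongr

lemma aux_prod (L K : ℕ) (hL : 0 < L) :
    ∏ n ∈ Finset.range K, (((n : ℝ) + L) / ((K + L : ℕ) : ℝ)) ≤
      Real.exp 1 * ((K + L : ℕ) : ℝ) ^ (L + 1) * Real.exp (-((K + L : ℕ) : ℝ)) := by
  have h1 : ∏ n ∈ Finset.range K, ((n : ℝ) + L) ≤ ((K + L).factorial : ℝ) := by
    clear hL
    induction K with
    | zero => simp; exact_mod_cast Nat.factorial_pos L
    | succ K ih =>
      rw [Finset.prod_range_succ, show K + 1 + L = (K + L) + 1 by ring, Nat.factorial_succ]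
      push_cast
      rw [mul_comm]
      exact mul_le_mul (by linarith) ih (Finset.prod_nonneg fun n _ => by positivity)
        (by positivity)
  have hp : (0 : ℝ) < ((K + L : ℕ) : ℝ) := by exact_mod_cast (by omega : 0 < K + L)
  rw [Finset.prod_div_distrib, Finset.prod_const, Finset.card_range, div_le_iff₀ (by positivity)]
  refine (h1.trans (aux_fact (K + L) (by omega))).trans (le_of_eq ?_)
  generalize hr : ((K + L : ℕ) : ℝ) = r
  ring

lemma aux_growth (M : ℕ) (t : Fin M → ℝ) (ht : Function.Injective t)
    (ht0 : ∀ j, 0 ≤ t j) (ht1 : ∀ j, t j < 1) (f : ℂ → ℂ) (hf : Differentiable ℂ f)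
    (A B : ℝ) (hA : 0 ≤ A) (hB : 0 ≤ B) (hb : ∀ s, ‖f s‖ ≤ A * Real.exp (B * ‖s‖))
    (hBM : B < 2 * M) (hz : ∀ j (n : ℤ), f ((t j : ℂ) + n) = 0) (c : ℂ) : f c = 0 := by
  obtain ⟨L, hL⟩ := exists_nat_gt (1 + ‖c‖)
  have hL0 : 0 < L := by
    have : (0 : ℝ) < L := by linarith [norm_nonneg c]
    exact_mod_cast this
  let w : Bool × ℕ → ℤ := fun p => if p.1 then (p.2 : ℤ) else -(p.2 : ℤ) - 1
  have hw : Function.Injective w := by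
    rintro ⟨b, n⟩ ⟨b', n'⟩ h
    cases b <;> cases b' <;> simp [w] at h ⊢ <;> omega
  let a : Fin M × Bool × ℕ → ℂ := fun p => (t p.1 : ℂ) + w p.2 - c
  have hfl : ∀ j (n : ℤ), ⌊t j + n⌋ = n := by
    intro j n
    rw [Int.floor_add_intCast, Int.floor_eq_zero_iff.2 ⟨ht0 j, ht1 j⟩, zero_add]
  have ha : Function.Injective a := by
    rintro ⟨j, p⟩ ⟨j', p'⟩ h
    have h1 : t j + w p = t j' + w p' := by
      have : ((t j : ℂ) + w p) = (t j' : ℂ) + w p' := by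
        simpa [a] using h
      exact_mod_cast this
    have h2 : w p = w p' := by rw [← hfl j (w p), h1, hfl]
    rw [h2] at h1
    rw [hw h2, ht (add_right_cancel h1)]
  have hna : ∀ j b n, ‖a (j, b, n)‖ ≤ n + L := by
    intro j b n
    have h1 : ‖(t j : ℂ) + w (b, n)‖ ≤ n + 1 := by
      have : ((t j : ℂ) + w (b, n)) = ((t j + w (b, n) : ℝ) : ℂ) := by push_cast; rfl
      rw [this, Complex.norm_real, Real.norm_eq_abs, abs_le]
      have := ht0 j
      have := ht1 j
      have : (0 : ℝ) ≤ n := Nat.cast_nonneg n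
      cases b <;> simp [w] <;> constructor <;> linarith
    calc ‖a (j, b, n)‖ ≤ ‖(t j : ℂ) + w (b, n)‖ + ‖c‖ := norm_sub_le _ _
      _ ≤ _ := by linarith
  have hmain : ∀ K : ℕ, ‖f c‖ ≤ A * Real.exp (B * ‖c‖) * Real.exp 1 ^ (2 * M) *
      (((K + L : ℕ) : ℝ) ^ ((L + 1) * (2 * M)) * Real.exp (-(2 * M - B) * ((K + L : ℕ) : ℝ))) := by
    intro K
    have hR : (0 : ℝ) < ((K + L : ℕ) : ℝ) := by exact_mod_cast (by omega : 0 < K + L)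
    have hbl := aux_blaschke a ha ((K + L : ℕ) : ℝ) hR
      (Finset.univ ×ˢ Finset.univ ×ˢ Finset.range K) (fun s => f (s + c))
      (hf.comp (differentiable_id.add_const c)) (A * Real.exp (B * (((K + L : ℕ) : ℝ) + ‖c‖))) ?_ ?_ ?_
    · simp only [zero_add] at hbl
      have hprod : ∏ i ∈ (Finset.univ ×ˢ Finset.univ ×ˢ Finset.range K : Finset (Fin M × Bool × ℕ)),
          (‖a i‖ / ((K + L : ℕ) : ℝ)) ≤
          (Real.exp 1 * ((K + L : ℕ) : ℝ) ^ (L + 1) * Real.exp (-((K + L : ℕ) : ℝ))) ^ (2 * M) := by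
        calc _ ≤ ∏ i ∈ (Finset.univ ×ˢ Finset.univ ×ˢ Finset.range K : Finset (Fin M × Bool × ℕ)),
              (((i.2.2 : ℝ) + L) / ((K + L : ℕ) : ℝ)) := by
              apply Finset.prod_le_prod
              · intro i _; positivity
              · rintro ⟨j, b, n⟩ _
                have := hna j b n
                gcongr
          _ = (∏ n ∈ Finset.range K, (((n : ℝ) + L) / ((K + L : ℕ) : ℝ))) ^ (2 * M) := by
              rw [Finset.prod_product]
              simp only [Finset.prod_product, Finset.prod_const, Finset.card_univ, Fintype.card_fin,
                Fintype.card_bool]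
              rw [pow_mul]
          _ ≤ _ := by
              apply pow_le_pow_left₀
              · exact Finset.prod_nonneg fun n _ => by positivity
              · exact aux_prod L K hL0
      refine (hbl.trans (mul_le_mul_of_nonneg_left hprod (by positivity))).trans (le_of_eq ?_)
      generalize ((K + L : ℕ) : ℝ) = r
      rw [mul_pow, mul_pow, ← Real.exp_nat_mul (-r), ← pow_mul, mul_add, Real.exp_add,
        show -(2 * (M : ℝ) - B) * r = B * r + ((2 * M : ℕ) : ℝ) * -r by push_cast; ring, Real.exp_add]
      ring
    · intro z hzR
      refine (hb _).trans ?_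
      gcongr
      rw [← hzR]; exact norm_add_le _ _
    · rintro ⟨j, b, n⟩ hi
      simp only [Finset.mem_product, Finset.mem_univ, Finset.mem_range, true_and] at hi
      refine (hna j b n).trans_lt ?_
      push_cast
      have : (n : ℝ) < K := by exact_mod_cast hi
      linarith
    · rintro ⟨j, b, n⟩ hi
      simp only [a, sub_add_cancel]
      exact hz j _
  have hlim : Filter.Tendsto (fun K : ℕ => A * Real.exp (B * ‖c‖) * Real.exp 1 ^ (2 * M) *
      (((K + L : ℕ) : ℝ) ^ ((L + 1) * (2 * M)) * Real.exp (-(2 * M - B) * ((K + L : ℕ) : ℝ))))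
      Filter.atTop (nhds 0) := by
    have h1 := tendsto_rpow_mul_exp_neg_mul_atTop_nhds_zero (((L + 1) * (2 * M) : ℕ) : ℝ)
      (2 * M - B) (by linarith)
    have h2 : Filter.Tendsto (fun K : ℕ => ((K + L : ℕ) : ℝ)) Filter.atTop Filter.atTop :=
      tendsto_natCast_atTop_atTop.comp (Filter.tendsto_add_atTop_nat L)
    have h3 := (h1.comp h2).const_mul (A * Real.exp (B * ‖c‖) * Real.exp 1 ^ (2 * M))
    rw [mul_zero] at h3
    refine h3.congr fun K => ?_
    simp only [Function.comp, Real.rpow_natCast]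
  have := ge_of_tendsto' hlim hmain
  exact norm_le_zero_iff.1 this

lemma aux_points (h : ℂ → ℂ) (hh : Differentiable ℂ h) (hne : ∃ s, h s ≠ 0) (M : ℕ) :
    ∃ t : Fin M → ℝ, Function.Injective t ∧ (∀ j, 0 ≤ t j) ∧ (∀ j, t j < 1) ∧
      ∀ j (n : ℤ), h ((t j : ℂ) + n) ≠ 0 := by
  obtain ⟨x, hx⟩ := hne
  have hc : (h ⁻¹' {0}).Countable := by
    rw [← Set.inter_univ (h ⁻¹' {0})]
    apply (HereditarilyLindelofSpace.isLindelof _).countable_of_isDiscrete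
      (isDiscrete_of_codiscreteWithin (U := Set.univ) _)
    have ha : AnalyticOnNhd ℂ h Set.univ := hh.differentiableOn.analyticOnNhd isOpen_univ
    exact ha.preimage_zero_mem_codiscrete hx
  have hc2 : (⋃ n : ℤ, (fun r : ℝ => ((r : ℂ) + n)) ⁻¹' (h ⁻¹' {0})).Countable := by
    refine Set.countable_iUnion fun n => hc.preimage ?_
    intro r r' hr
    simpa using hr
  have hinf : (Set.Ico (0 : ℝ) 1 \ ⋃ n : ℤ, (fun r : ℝ => ((r : ℂ) + n)) ⁻¹' (h ⁻¹' {0})).Infinite := by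
    intro hfin
    have h1 : (Set.Ico (0 : ℝ) 1).Countable :=
      (hfin.countable.union hc2).mono (by intro y hy; by_cases hy' : y ∈ ⋃ n : ℤ, (fun r : ℝ => ((r : ℂ) + n)) ⁻¹' (h ⁻¹' {0}); exacts [Or.inr hy', Or.inl ⟨hy, hy'⟩])
    rw [← Cardinal.le_aleph0_iff_set_countable, Cardinal.mk_Ico_real one_pos] at h1
    exact absurd h1 (not_le.2 Cardinal.aleph0_lt_continuum)
  obtain ⟨T, hT, hcard⟩ := hinf.exists_subset_card_eq M
  let e := (T.equivFinOfCardEq hcard).symm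
  refine ⟨fun j => (e j : ℝ), fun i j hij => e.injective (Subtype.ext hij), fun j => (hT (e j).2).1.1,
    fun j => (hT (e j).2).1.2, fun j n hn => (hT (e j).2).2 ?_⟩
  exact Set.mem_iUnion.2 ⟨n, hn⟩

lemma aux_poly_bound (N : ℕ) (u : Fin (N + 1) → ℂ) (s : ℂ) :
    ‖(∑ k, u k * Complex.exp (2 * (Real.pi : ℂ) * Complex.I * s) ^ (k : ℕ)) *
      Complex.exp (-((Real.pi : ℂ) * N * Complex.I * s))‖ ≤
      (∑ k, ‖u k‖) * Real.exp (Real.pi * N * ‖s‖) := by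
  rw [Finset.sum_mul, Finset.sum_mul]
  refine norm_sum_le_of_le _ fun k _ => ?_
  rw [← Complex.exp_nat_mul, mul_assoc, ← Complex.exp_add, norm_mul]
  gcongr
  refine (Complex.norm_exp_le_exp_norm _).trans ?_
  rw [Real.exp_le_exp]
  have e : ((k : ℕ) : ℂ) * (2 * (Real.pi : ℂ) * Complex.I * s) + -((Real.pi : ℂ) * N * Complex.I * s)
      = (((2 * (k : ℕ) - N) * Real.pi : ℝ) : ℂ) * Complex.I * s := by push_cast; ring
  rw [e, norm_mul, norm_mul, Complex.norm_I, mul_one, Complex.norm_real, Real.norm_eq_abs, abs_mul,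
    abs_of_pos Real.pi_pos, mul_comm Real.pi]
  have hk : ((k : ℕ) : ℝ) ≤ N := by exact_mod_cast Nat.lt_succ_iff.1 k.2
  have hk0 : (0 : ℝ) ≤ ((k : ℕ) : ℝ) := Nat.cast_nonneg _
  gcongr
  rw [abs_le]; constructor <;> linarith

lemma aux_ker (N : ℕ) (z α β : Fin (2 * N + 1) → ℂ) :
    ∃ u v : Fin (N + 1) → ℂ, (u, v) ≠ 0 ∧
      ∀ j, (∑ k, u k * z j ^ (k : ℕ)) * α j = (∑ k, v k * z j ^ (k : ℕ)) * β j := by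
  let F : ((Fin (N + 1) → ℂ) × (Fin (N + 1) → ℂ)) →ₗ[ℂ] (Fin (2 * N + 1) → ℂ) :=
    { toFun := fun p j => (∑ k, p.1 k * z j ^ (k : ℕ)) * α j - (∑ k, p.2 k * z j ^ (k : ℕ)) * β j
      map_add' := by
        intro p q; ext j
        simp only [Prod.fst_add, Prod.snd_add, Pi.add_apply, add_mul, Finset.sum_add_distrib]
        ring
      map_smul' := by
        intro r p; ext j
        simp only [Prod.smul_fst, Prod.smul_snd, Pi.smul_apply, smul_eq_mul, RingHom.id_apply,
          mul_assoc, ← Finset.mul_sum]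
        ring }
  have hF : LinearMap.ker F ≠ ⊥ := LinearMap.ker_ne_bot_of_finrank_lt (by simp; omega)
  obtain ⟨p, hp, hp0⟩ := (Submodule.ne_bot_iff _).1 hF
  refine ⟨p.1, p.2, hp0, fun j => ?_⟩
  have := congrFun (LinearMap.mem_ker.1 hp) j
  exact sub_eq_zero.1 this

/-- If `g, h` are entire, exponentially bounded, `h` not identically zero,
and `g/h` is 1-periodic (cross-multiplied form), then `g/h = f(e^{2πis})` for a
rational function `f = p/q`. -/
theorem exp_bounded_periodic_quotient_is_rational_in_exp
    (g h : ℂ → ℂ) (hg : Differentiable ℂ g) (hh : Differentiable ℂ h)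
    (hne : ∃ s, h s ≠ 0)
    (hbound : ∃ C > 0, ∃ C' > 0, ∀ s : ℂ,
      ‖g s‖ ≤ C' * Real.exp (C * ‖s‖) ∧ ‖h s‖ ≤ C' * Real.exp (C * ‖s‖))
    (hper : ∀ s : ℂ, g (s + 1) * h s = g s * h (s + 1)) :
    ∃ p q : Polynomial ℂ, q ≠ 0 ∧ ∀ s : ℂ, h s ≠ 0 →
      q.eval (Complex.exp (2 * (Real.pi : ℂ) * Complex.I * s)) ≠ 0 →
      g s / h s = p.eval (Complex.exp (2 * (Real.pi : ℂ) * Complex.I * s)) /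
        q.eval (Complex.exp (2 * (Real.pi : ℂ) * Complex.I * s)) := by
  obtain ⟨C, hC, C', hC', hb⟩ := hbound
  obtain ⟨N, hN⟩ := exists_nat_gt (2 * C)
  obtain ⟨t, htinj, ht0, ht1, hth⟩ := aux_points h hh hne (2 * N + 1)
  let E : ℂ → ℂ := fun s => Complex.exp (2 * (Real.pi : ℂ) * Complex.I * s)
  have hE1 : ∀ s, E (s + 1) = E s := by
    intro s
    simp only [E, mul_add, mul_one, Complex.exp_add, Complex.exp_two_pi_mul_I]
  obtain ⟨u, v, huv, hker⟩ := aux_ker N (fun j => E (t j)) (fun j => h (t j)) (fun j => g (t j))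
  let P : ℂ → ℂ := fun s => ∑ k, u k * E s ^ (k : ℕ)
  let Q : ℂ → ℂ := fun s => ∑ k, v k * E s ^ (k : ℕ)
  have hP1 : ∀ s, P (s + 1) = P s := fun s => by simp only [P, hE1]
  have hQ1 : ∀ s, Q (s + 1) = Q s := fun s => by simp only [Q, hE1]
  have hPd : Differentiable ℂ P := by simp only [P, E]; fun_prop
  have hQd : Differentiable ℂ Q := by simp only [Q, E]; fun_prop
  let Φ : ℂ → ℂ := fun s => P s * h s - Q s * g s
  have hΦ1 : ∀ s, Φ (s + 1) * h s = Φ s * h (s + 1) := by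
    intro s
    simp only [Φ, hP1, hQ1]
    linear_combination (-Q s) * hper s
  have hup : ∀ j (n : ℤ), Φ ((t j : ℂ) + n) = 0 := by
    intro j n
    induction n using Int.induction_on with
    | zero => simpa [Φ, sub_eq_zero] using hker j
    | succ n ih =>
      have := hΦ1 ((t j : ℂ) + (n : ℤ))
      rw [ih, zero_mul] at this
      have := (mul_eq_zero.1 this).resolve_right (hth j _)
      rw [← this]; congr 1; push_cast; ring
    | pred n ih =>
      have := hΦ1 ((t j : ℂ) + ((-(n : ℤ) - 1 : ℤ)))
      have e : (t j : ℂ) + ((-(n : ℤ) - 1 : ℤ)) + 1 = (t j : ℂ) + ((-(n : ℤ) : ℤ)) := by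
        push_cast; ring
      rw [e, ih, zero_mul] at this
      exact (mul_eq_zero.1 this.symm).resolve_right (hth j _)
  have hzero : ∀ s, P s * h s = Q s * g s := by
    intro s
    have key := aux_growth (2 * N + 1) t htinj ht0 ht1
      (fun s => Φ s * Complex.exp (-((Real.pi : ℂ) * N * Complex.I * s)))
      (((hPd.mul hh).sub (hQd.mul hg)).mul (by fun_prop))
      (((∑ k, ‖u k‖) + ∑ k, ‖v k‖) * C') (Real.pi * N + C)
      (by positivity) (by positivity) ?_ ?_ (fun j n => by simp only [hup, zero_mul]) s
    · exact sub_eq_zero.1 ((mul_eq_zero.1 key).resolve_right (Complex.exp_ne_zero _))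
    · intro s
      have h1 := aux_poly_bound N u s
      have h2 := aux_poly_bound N v s
      obtain ⟨hgs, hhs⟩ := hb s
      have e : Φ s * Complex.exp (-((Real.pi : ℂ) * N * Complex.I * s)) =
        (P s * Complex.exp (-((Real.pi : ℂ) * N * Complex.I * s))) * h s -
        (Q s * Complex.exp (-((Real.pi : ℂ) * N * Complex.I * s))) * g s := by
        simp only [Φ]; ring
      rw [e]
      refine (norm_sub_le _ _).trans ?_
      rw [norm_mul _ (h s), norm_mul _ (g s)]
      refine (add_le_add (mul_le_mul h1 hhs (norm_nonneg _) (by positivity))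
        (mul_le_mul h2 hgs (norm_nonneg _) (by positivity))).trans (le_of_eq ?_)
      rw [add_mul (Real.pi * N), Real.exp_add]
      ring
    · have := Real.pi_lt_d2
      have : (0 : ℝ) ≤ N := Nat.cast_nonneg _
      push_cast
      nlinarith
  let p : Polynomial ℂ := ∑ k : Fin (N + 1), Polynomial.monomial (k : ℕ) (u k)
  let q : Polynomial ℂ := ∑ k : Fin (N + 1), Polynomial.monomial (k : ℕ) (v k)
  have hp : ∀ s, p.eval (E s) = P s := fun s => by
    simp [p, P, Polynomial.eval_finsetSum]
  have hq : ∀ s, q.eval (E s) = Q s := fun s => by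
    simp [q, Q, Polynomial.eval_finsetSum]
  have hcoef : ∀ w : Fin (N + 1) → ℂ,
      (∑ k : Fin (N + 1), Polynomial.monomial (k : ℕ) (w k)) = 0 → w = 0 := by
    intro w hw
    ext i
    have := congrArg (fun r => Polynomial.coeff r (i : ℕ)) hw
    simpa [Polynomial.finsetSum_coeff, Polynomial.coeff_monomial, Fin.val_inj] using this
  refine ⟨p, q, ?_, ?_⟩
  · intro hq0
    have hv : v = 0 := hcoef v hq0
    have hQ0 : ∀ s, Q s = 0 := fun s => by rw [← hq, hq0, Polynomial.eval_zero]
    have hp0 : p ≠ 0 := fun hp0 => huv (by rw [hcoef u hp0, hv]; rfl)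
    obtain ⟨x, hx⟩ := hne
    have hev : ∀ᶠ s in nhds x, P s = 0 := by
      filter_upwards [hh.continuous.continuousAt.eventually_ne hx] with s hs
      have := hzero s
      rw [hQ0, zero_mul] at this
      exact (mul_eq_zero.1 this).resolve_right hs
    have hPa : AnalyticOnNhd ℂ P Set.univ := hPd.differentiableOn.analyticOnNhd isOpen_univ
    have hP0 : ∀ s, P s = 0 := fun s =>
      hPa.eqOn_zero_of_preconnected_of_eventuallyEq_zero isPreconnected_univ (Set.mem_univ x) hev
        (Set.mem_univ s)
    apply hp0
    apply Polynomial.eq_zero_of_infinite_isRoot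
    have : ({0}ᶜ : Set ℂ) ⊆ {x | p.IsRoot x} := by
      intro y hy
      have hE : E (Complex.log y / (2 * (Real.pi : ℂ) * Complex.I)) = y := by
        simp only [E]
        rw [mul_div_cancel₀ _ Complex.two_pi_I_ne_zero, Complex.exp_log hy]
      show p.eval y = 0
      rw [← hE, hp, hP0]
    exact (Set.finite_singleton (0 : ℂ)).infinite_compl.mono this
  · intro s hs hqs
    change q.eval (E s) ≠ 0 at hqs
    change g s / h s = p.eval (E s) / q.eval (E s)
    rw [hq] at hqs ⊢
    rw [hp, div_eq_div_iff hs hqs]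
    rw [hzero s]; ring
end

section
/- Let s ∈ ℂ be such that both s and e^{2πis} are algebraic numbers. Then s is rational, and hence e^{2πis} is a root of unity. -/
open Complex
open NumberField

/-- A polynomial expression with infinitely many zeros has zero coefficients. -/
lemma gs_coeff_zero {K : Type*} [Field K] {n : ℕ} (c : Fin n → K) (u : ℕ → K)
    (hu : Function.Injective u) (h : ∀ m, ∑ i, c i * u m ^ (i : ℕ) = 0) : ∀ i, c i = 0 := by
  classical
  set p : Polynomial K := ∑ i, Polynomial.C (c i) * Polynomial.X ^ (i : ℕ) with hp
  have hp0 : p = 0 := by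
    apply Polynomial.eq_zero_of_infinite_isRoot
    refine (Set.infinite_range_of_injective hu).mono ?_
    rintro _ ⟨m, rfl⟩
    simpa [Polynomial.IsRoot, hp, Polynomial.eval_finsetSum] using h m
  intro i
  have : p.coeff i = c i := by
    simp only [hp, Polynomial.finsetSum_coeff, Polynomial.coeff_C_mul, Polynomial.coeff_X_pow]
    rw [Finset.sum_eq_single i]
    · simp
    · intro j _ hj
      simp [Fin.val_inj, hj.symm]
    · simp
  rw [← this, hp0]; simp

/-- Entire functions vanishing on a finite set are divisible by the corresponding polynomial. -/
lemma gs_factor (S : Finset ℂ) : ∀ f : ℂ → ℂ, Differentiable ℂ f → (∀ z ∈ S, f z = 0) →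
    ∃ g : ℂ → ℂ, Differentiable ℂ g ∧ ∀ z, f z = (∏ a ∈ S, (z - a)) * g z := by
  classical
  induction S using Finset.induction_on with
  | empty => intro f hf _; exact ⟨f, hf, by simp⟩
  | insert a S ha ih =>
    intro f hf h0
    have hfa : f a = 0 := h0 a (by simp)
    have hmul : ∀ z, f z = (z - a) * dslope f a z := by
      intro z
      have := sub_smul_dslope f a z
      rw [hfa, sub_zero, smul_eq_mul] at this
      exact this.symm
    have hd : Differentiable ℂ (dslope f a) := by
      have := (Complex.differentiableOn_dslope (f := f) (c := a) (s := Set.univ) Filter.univ_mem).2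
        hf.differentiableOn
      exact differentiableOn_univ.1 this
    obtain ⟨g, hg, hfg⟩ := ih (dslope f a) hd (by
      intro z hz
      have h1 : f z = 0 := h0 z (by simp [hz])
      rw [hmul z] at h1
      rcases mul_eq_zero.1 h1 with h | h
      · exact absurd (sub_eq_zero.1 h ▸ hz) ha
      · exact h)
    refine ⟨g, hg, fun z => ?_⟩
    rw [hmul z, hfg z, Finset.prod_insert ha, mul_assoc]

/-- Schwarz lemma with many zeros. -/
lemma gs_schwarz (S : Finset ℂ) (f : ℂ → ℂ) (hf : Differentiable ℂ f) (h0 : ∀ z ∈ S, f z = 0)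
    (r M : ℝ) (hr : 0 < r) (hS : ∀ z ∈ S, ‖z‖ ≤ r) (hM : ∀ z, ‖z‖ = 5 * r → ‖f z‖ ≤ M)
    (w : ℂ) (hw : ‖w‖ ≤ r) : ‖f w‖ ≤ M / 2 ^ S.card := by
  obtain ⟨g, hg, hfg⟩ := gs_factor S f hf h0
  have hg1 : ∀ z, ‖z‖ = 5 * r → ‖g z‖ ≤ M / (4 * r) ^ S.card := by
    intro z hz
    rw [le_div_iff₀ (by positivity)]
    refine le_trans ?_ (hM z hz)
    rw [hfg z, norm_mul, norm_prod, mul_comm]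
    gcongr
    rw [← Finset.prod_const]
    apply Finset.prod_le_prod
    · intros; positivity
    · intro a ha
      have := norm_sub_norm_le z a
      have := hS a ha
      linarith
  have hg2 : ‖g w‖ ≤ M / (4 * r) ^ S.card := by
    apply Complex.norm_le_of_forall_mem_frontier_norm_le (U := Metric.ball 0 (5 * r))
      Metric.isBounded_ball hg.diffContOnCl
    · intro z hz
      rw [frontier_ball _ (by positivity)] at hz
      exact hg1 z (by simpa using hz)
    · apply subset_closure
      simp; linarith
  have hM0 : 0 ≤ M := by
    refine le_trans (norm_nonneg _) (hM ((5 * r : ℝ) : ℂ) ?_)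
    rw [Complex.norm_real, Real.norm_of_nonneg (by positivity)]
  rw [hfg w, norm_mul, norm_prod]
  calc _ ≤ (2 * r) ^ S.card * (M / (4 * r) ^ S.card) := by
        gcongr
        rw [← Finset.prod_const]
        apply Finset.prod_le_prod
        · intros; positivity
        · intro a ha
          have := norm_sub_le w a
          have := hS a ha
          linarith
    _ = M / 2 ^ S.card := by
        rw [show (4 * r) = 2 * (2 * r) by ring, mul_pow 2 (2 * r)]
        field_simp

lemma gs_growth (C : ℝ) (k : ℕ) : ∃ t : ℕ, 1 ≤ t ∧ ∀ n : ℕ, t ≤ n → (C * n) ^ k < 2 ^ n := by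
  have h := tendsto_pow_const_div_const_pow_of_one_lt k (r := (2:ℝ)) (by norm_num)
  have h2 := (h.const_mul (C ^ k))
  rw [mul_zero] at h2
  have h3 := h2.eventually (gt_mem_nhds (zero_lt_one))
  obtain ⟨t, ht⟩ := Filter.eventually_atTop.1 h3
  refine ⟨max 1 t, le_max_left _ _, fun n hn => ?_⟩
  have := ht n (le_trans (le_max_right _ _) hn)
  rw [← mul_div_assoc, div_lt_one (by positivity), ← mul_pow] at this
  exact this


/-- Values of the auxiliary function. -/
noncomputable def gsV {K : Type*} [Field K] (s g : K) {D E : ℕ} (x : Fin D × Fin E → K)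
    (a b : ℕ) : K := ∑ l, x l * (((a : K) + b * s) ^ (l.1 : ℕ) * g ^ (b * (l.2 : ℕ)))

lemma gs_nonvanish {K : Type*} [Field K] [CharZero K] (s g : K) {D E : ℕ}
    (x : Fin D × Fin E → K) (hg : Function.Injective (fun b : ℕ => g ^ b))
    (h : ∀ a b, gsV s g x a b = 0) : x = 0 := by
  have h1 : ∀ (b : ℕ) (i : Fin D), ∑ j, x (i, j) * (g ^ b) ^ (j : ℕ) = 0 := by
    intro b
    apply gs_coeff_zero _ (fun a : ℕ => (a : K) + b * s)
    · intro a a' haa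
      simpa using haa
    · intro a
      rw [← h a b, gsV, Fintype.sum_prod_type]
      refine Finset.sum_congr rfl fun i _ => ?_
      rw [Finset.sum_mul]
      refine Finset.sum_congr rfl fun j _ => ?_
      rw [pow_mul]; ring
  ext ⟨i, j⟩
  exact gs_coeff_zero (fun j => x (i, j)) (fun b => g ^ b) hg (fun b => h1 b i) j

/-- Integrality and size of the basic monomials. -/
lemma gs_entry {K : Type*} [Field K] [NumberField K] (s g : K) (d H n : ℕ) (hn : 1 ≤ n)
    (hds : IsIntegral ℤ (d * s)) (hdg : IsIntegral ℤ (d * g)) (hdH : d ≤ H) (hH : 1 ≤ H)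
    (hs : 1 + house s ≤ H) (hg : 1 + house g ≤ H) (a b i j : ℕ)
    (hi : i ≤ n ^ 3) (hj : b * j ≤ 8 * n ^ 3) (ha : a ≤ 4 * n ^ 2) (hb : b ≤ 4 * n ^ 2) :
    IsIntegral ℤ ((d : K) ^ (9 * n ^ 3) * (((a : K) + b * s) ^ i * g ^ (b * j))) ∧
    house ((d : K) ^ (9 * n ^ 3) * (((a : K) + b * s) ^ i * g ^ (b * j)))
      ≤ ((4 * H : ℝ) * n) ^ (18 * n ^ 3) := by
  have hdint : IsIntegral ℤ (d : K) := by simpa using isIntegral_algebraMap (R := ℤ) (A := K) (x := (d : ℤ))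
  have hnat : ∀ m : ℕ, IsIntegral ℤ (m : K) := fun m => by
    simpa using isIntegral_algebraMap (R := ℤ) (A := K) (x := (m : ℤ))
  have hhn : ∀ m : ℕ, house (m : K) = m := fun m => by
    have := house_intCast (K := K) (m : ℤ)
    simpa using this
  constructor
  · obtain ⟨u, hu⟩ : ∃ u, 9 * n ^ 3 = u + i + b * j := ⟨9 * n ^ 3 - i - b * j, by omega⟩
    have : (d : K) ^ (9 * n ^ 3) * (((a : K) + b * s) ^ i * g ^ (b * j)) =
        (d : K) ^ u * (((d : K) * a + b * (d * s)) ^ i * (d * g) ^ (b * j)) := by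
      rw [hu, pow_add, pow_add, show (d : K) * a + b * (d * s) = d * (a + b * s) by ring, mul_pow,
        mul_pow]
      ring
    rw [this]
    exact (hdint.pow _).mul (((((hdint.mul (hnat a)).add ((hnat b).mul hds))).pow _).mul
      (hdg.pow _))
  · have h1 : house (d : K) ≤ H := by rw [hhn]; exact_mod_cast hdH
    have hs0 := house_nonneg s
    have hg0 := house_nonneg g
    have hH1 : (1 : ℝ) ≤ H := by exact_mod_cast hH
    have hn1 : (1 : ℝ) ≤ n := by exact_mod_cast hn
    have h2 : house ((a : K) + b * s) ≤ 4 * n ^ 2 * H := by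
      have ha' : (a : ℝ) ≤ 4 * n ^ 2 := by exact_mod_cast ha
      have hb' : (b : ℝ) ≤ 4 * n ^ 2 := by exact_mod_cast hb
      calc _ ≤ house (a : K) + house ((b : K) * s) := house_add_le _ _
        _ = a + b * house s := by rw [hhn, house_nat_mul]
        _ ≤ 4 * n ^ 2 + 4 * n ^ 2 * house s := by gcongr
        _ = 4 * n ^ 2 * (1 + house s) := by ring
        _ ≤ _ := by gcongr
    have hL : (1 : ℝ) ≤ 4 * n ^ 2 * H := by
      have : (1 : ℝ) ≤ n ^ 2 := one_le_pow₀ hn1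
      nlinarith
    calc _ ≤ house ((d : K) ^ (9 * n ^ 3)) * (house (((a : K) + b * s) ^ i) * house (g ^ (b * j))) := by
          refine (house_mul_le _ _).trans ?_
          gcongr
          · exact house_nonneg _
          · exact house_mul_le _ _
      _ ≤ house (d : K) ^ (9 * n ^ 3) * (house ((a : K) + b * s) ^ i * house g ^ (b * j)) := by
          gcongr
          any_goals apply_rules [mul_nonneg, house_nonneg, pow_nonneg]
          all_goals exact house_pow_le _ _
      _ ≤ (H : ℝ) ^ (9 * n ^ 3) * ((4 * n ^ 2 * H : ℝ) ^ i * (H : ℝ) ^ (b * j)) := by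
          gcongr
          any_goals apply_rules [mul_nonneg, house_nonneg, pow_nonneg]
          linarith
      _ ≤ (H : ℝ) ^ (9 * n ^ 3) * ((4 * n ^ 2 * H : ℝ) ^ (n ^ 3) * (H : ℝ) ^ (8 * n ^ 3)) := by
          gcongr
      _ = ((H : ℝ) ^ 9 * (4 * n ^ 2 * H) * H ^ 8) ^ (n ^ 3) := by
          rw [pow_mul (H : ℝ) 9, pow_mul (H : ℝ) 8, ← mul_pow, ← mul_pow, ← mul_assoc]
      _ ≤ (((4 * H : ℝ) * n) ^ 18) ^ (n ^ 3) := by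
          gcongr
          have e1 : (H : ℝ) ^ 9 * (4 * n ^ 2 * H) * H ^ 8 = H ^ 18 * (4 * n ^ 2) := by ring
          have e2 : ((4 * H : ℝ) * n) ^ 18 = H ^ 18 * (4 ^ 18 * n ^ 18) := by ring
          rw [e1, e2]
          gcongr
          · norm_num
          · norm_num
      _ = _ := by rw [← pow_mul]

lemma gs_siegel {K : Type*} [Field K] [NumberField K] (s g : K) (d H : ℕ)
    (hds : IsIntegral ℤ (d * s)) (hdg : IsIntegral ℤ (d * g)) (hd : 1 ≤ d) (hdH : d ≤ H)
    (hs : 1 + house s ≤ H) (hg : 1 + house g ≤ H) :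
    ∃ C : ℕ, 4 * H ≤ C ∧ ∀ t : ℕ, 1 ≤ t → ∃ x : Fin (t ^ 3) × Fin (2 * t) → 𝓞 K, x ≠ 0 ∧
      (∀ a b, a < t ^ 2 → b < t ^ 2 → gsV s g (fun l => (x l : K)) a b = 0) ∧
      ∀ l, house (x l : K) ≤ ((C : ℝ) * t) ^ (22 * t ^ 3) := by
  classical
  obtain ⟨c, hc⟩ : ∃ c : ℝ, ∀ (t : ℕ), 1 ≤ t → ∀ A : ℝ,
      ∀ M : Matrix (Fin (t ^ 2) × Fin (t ^ 2)) (Fin (t ^ 3) × Fin (2 * t)) (𝓞 K), M ≠ 0 →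
      (∀ k l, house (algebraMap (𝓞 K) K (M k l)) ≤ A) →
      ∃ ξ : Fin (t ^ 3) × Fin (2 * t) → 𝓞 K, ξ ≠ 0 ∧ M.mulVec ξ = 0 ∧
        ∀ l, house (ξ l).1 ≤ c * ((c * (2 * t ^ 4 : ℕ) * A) ^
          (((t ^ 4 : ℕ) : ℝ) / ((2 * t ^ 4 : ℕ) - (t ^ 4 : ℕ)))) := by
    apply Exists.intro
    intro t ht A M hM hA
    have ht4 : 0 < t ^ 4 := by positivity
    exact NumberField.house.exists_ne_zero_int_vec_house_le K M hM (p := t ^ 4) (q := 2 * t ^ 4)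
      ht4 (by omega) (by simp; ring) hA (by simp; ring)
  obtain ⟨c', hc'⟩ := exists_nat_ge |c|
  refine ⟨4 * H + 2 * c', by omega, fun t ht => ?_⟩
  have key := fun (k : Fin (t ^ 2) × Fin (t ^ 2)) (l : Fin (t ^ 3) × Fin (2 * t)) =>
    gs_entry s g d H t ht hds hdg hdH (hd.trans hdH) hs hg k.1 k.2 l.1 l.2 l.1.2.le
      (by
        have h1 : (k.2 : ℕ) ≤ t ^ 2 := k.2.2.le
        have h2 : (l.2 : ℕ) ≤ 2 * t := l.2.2.le
        calc _ ≤ t ^ 2 * (2 * t) := Nat.mul_le_mul h1 h2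
          _ = 2 * t ^ 3 := by ring
          _ ≤ _ := by omega)
      (by have := k.1.2; omega) (by have := k.2.2; omega)
  let M : Matrix (Fin (t ^ 2) × Fin (t ^ 2)) (Fin (t ^ 3) × Fin (2 * t)) (𝓞 K) :=
    fun k l => ⟨_, (key k l).1⟩
  have hdK : (d : K) ≠ 0 := by
    have : d ≠ 0 := by omega
    exact_mod_cast this
  have hM : M ≠ 0 := by
    intro h
    have h2 : M (⟨0, by positivity⟩, ⟨0, by positivity⟩) (⟨0, by positivity⟩, ⟨0, by omega⟩) = 0 := by
      rw [h]; rfl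
    have h3 := congrArg (algebraMap (𝓞 K) K) h2
    rw [map_zero] at h3
    change (d : K) ^ (9 * t ^ 3) * _ = 0 at h3
    simp [hdK] at h3
  obtain ⟨x, hx0, hMx, hxb⟩ := hc t ht _ M hM (fun k l => (key k l).2)
  refine ⟨x, hx0, ?_, fun l => ?_⟩
  · intro a b ha hb
    have h1 := congrFun hMx (⟨a, ha⟩, ⟨b, hb⟩)
    have h3 := congrArg (algebraMap (𝓞 K) K) h1
    simp only [Matrix.mulVec, dotProduct, Pi.zero_apply, map_zero, map_sum, map_mul] at h3
    have h4 : (d : K) ^ (9 * t ^ 3) * gsV s g (fun l => (x l : K)) a b = 0 := by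
      rw [← h3, gsV, Finset.mul_sum]
      refine Finset.sum_congr rfl fun l _ => ?_
      change _ = ((d : K) ^ (9 * t ^ 3) * _) * (x l : K)
      ring
    simpa [hdK] using h4
  · refine (hxb l).trans ?_
    have ht1 : (1 : ℝ) ≤ t := by exact_mod_cast ht
    have e : (((t ^ 4 : ℕ) : ℝ) / ((2 * t ^ 4 : ℕ) - (t ^ 4 : ℕ))) = 1 := by
      push_cast
      rw [show (2 * (t : ℝ) ^ 4 - t ^ 4) = t ^ 4 by ring]
      exact div_self (by positivity)
    rw [e, Real.rpow_one]
    have hcc : c ^ 2 ≤ (c' : ℝ) ^ 2 := by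
      rw [← sq_abs c]; gcongr
    have hH0 : (0 : ℝ) ≤ H := by positivity
    have hc0 : (0 : ℝ) ≤ c' := by positivity
    have hH1 : (1 : ℝ) ≤ H := by exact_mod_cast hd.trans hdH
    push_cast
    calc _ = c ^ 2 * (2 * t ^ 4) * ((4 * H : ℝ) * t) ^ (18 * t ^ 3) := by ring
      _ ≤ (c' : ℝ) ^ 2 * (2 * t ^ 4) * ((4 * H : ℝ) * t) ^ (18 * t ^ 3) := by gcongr
      _ ≤ (((4 * H + 2 * c' : ℝ)) * t) ^ 4 * ((4 * H + 2 * c' : ℝ) * t) ^ (18 * t ^ 3) := by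
          gcongr
          · rw [mul_pow, ← mul_assoc]
            gcongr
            calc (c' : ℝ) ^ 2 * 2 ≤ (4 * H + 2 * c' : ℝ) ^ 2 := by nlinarith
              _ ≤ _ := by
                apply pow_le_pow_right₀ _ (by norm_num)
                linarith
          · linarith
      _ = ((4 * H + 2 * c' : ℝ) * t) ^ (4 + 18 * t ^ 3) := by rw [pow_add]
      _ ≤ _ := by
          apply pow_le_pow_right₀
          · nlinarith
          · have : 1 ≤ t ^ 3 := Nat.one_le_pow _ _ ht
            omega

/-- Bound for the auxiliary entire function. -/
lemma gs_F_bound {D E : ℕ} (y : Fin D × Fin E → ℂ) (X R : ℝ) (hX : ∀ l, ‖y l‖ ≤ X)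
    (hR : 1 ≤ R) (z : ℂ) (hz : ‖z‖ ≤ R) :
    ‖∑ l, y l * (z ^ (l.1 : ℕ) * Complex.exp (2 * (Real.pi : ℂ) * Complex.I * z) ^ (l.2 : ℕ))‖
      ≤ D * E * (X * (R ^ D * Real.exp (2 * Real.pi * R) ^ E)) := by
  have he : ‖Complex.exp (2 * (Real.pi : ℂ) * Complex.I * z)‖ ≤ Real.exp (2 * Real.pi * R) := by
    refine (Complex.norm_exp_le_exp_norm _).trans ?_
    apply Real.exp_le_exp.2
    simp only [norm_mul, Complex.norm_I, Complex.norm_real, Complex.norm_ofNat, mul_one,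
      Real.norm_of_nonneg Real.pi_pos.le]
    have := Real.pi_pos
    gcongr
  have he1 : 1 ≤ Real.exp (2 * Real.pi * R) := Real.one_le_exp (by have := Real.pi_pos; positivity)
  refine (norm_sum_le _ _).trans ?_
  calc _ ≤ ∑ _l : Fin D × Fin E, X * (R ^ D * Real.exp (2 * Real.pi * R) ^ E) := by
        refine Finset.sum_le_sum fun l _ => ?_
        rw [norm_mul, norm_mul, norm_pow, norm_pow]
        have hX0 : 0 ≤ X := (norm_nonneg _).trans (hX l)
        gcongr
        · exact hX l
        · exact (pow_le_pow_left₀ (norm_nonneg _) hz _).trans (pow_le_pow_right₀ hR l.1.2.le)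
        · exact (pow_le_pow_left₀ (norm_nonneg _) he _).trans (pow_le_pow_right₀ he1 l.2.2.le)
    _ = _ := by simp

lemma gs_step {K : Type*} [Field K] [NumberField K] (σ : K →+* ℂ) (s g : K) (d H : ℕ)
    (hexp : Complex.exp (2 * (Real.pi : ℂ) * Complex.I * σ s) = σ g)
    (hinj : ∀ a b a' b' : ℕ, (a : K) + b * s = a' + b' * s → a = a' ∧ b = b')
    (hds : IsIntegral ℤ (d * s)) (hdg : IsIntegral ℤ (d * g)) (hd : 1 ≤ d) (hdH : d ≤ H)
    (hs : 1 + house s ≤ H) (hg : 1 + house g ≤ H) (C : ℝ) (hCH : 20 * H ≤ C)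
    (hCe : Real.exp (80 * Real.pi * H) ≤ C) (t n : ℕ) (ht : 1 ≤ t) (htn : t ≤ n)
    (x : Fin (t ^ 3) × Fin (2 * t) → 𝓞 K)
    (hx : ∀ l, house (x l : K) ≤ (C * n) ^ (22 * n ^ 3))
    (hv : ∀ a b, a < n ^ 2 → b < n ^ 2 → gsV s g (fun l => (x l : K)) a b = 0)
    (hlt : (C * n) ^ (44 * Module.finrank ℚ K) < 2 ^ n) :
    ∀ a b, a < (n + 1) ^ 2 → b < (n + 1) ^ 2 → gsV s g (fun l => (x l : K)) a b = 0 := by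
  classical
  intro a b ha hb
  by_contra hne
  have hn : 1 ≤ n := ht.trans htn
  have hn1 : (1 : ℝ) ≤ n := by exact_mod_cast hn
  have htn' : (t : ℝ) ≤ n := by exact_mod_cast htn
  have hH1 : (1 : ℝ) ≤ H := by exact_mod_cast hd.trans hdH
  have hC1 : 20 ≤ C := by linarith
  have hn3 : 1 ≤ n ^ 3 := Nat.one_le_pow _ _ hn
  have ht3 : t ^ 3 ≤ n ^ 3 := Nat.pow_le_pow_left htn 3
  have h4 : (n + 1) ^ 2 ≤ 4 * n ^ 2 := by nlinarith
  set Q : ℝ := C * n with hQ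
  have hQ1 : 1 ≤ Q := by nlinarith
  have hQn : (n : ℝ) ≤ Q := by nlinarith
  have hQC : C ≤ Q := by nlinarith
  have hcount : ((t ^ 3 : ℕ) : ℝ) * (2 * t : ℕ) ≤ Q ^ (4 * n ^ 3) := by
    push_cast
    calc (t : ℝ) ^ 3 * (2 * t) = 2 * t ^ 4 := by ring
      _ ≤ C ^ 4 * n ^ 4 := by
        gcongr
        calc (2 : ℝ) ≤ C ^ 1 := by linarith
          _ ≤ C ^ 4 := pow_le_pow_right₀ (by linarith) (by norm_num)
      _ = Q ^ 4 := by rw [hQ, mul_pow]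
      _ ≤ _ := pow_le_pow_right₀ hQ1 (by omega)
  -- the algebraic integer
  have key := fun (l : Fin (t ^ 3) × Fin (2 * t)) =>
    gs_entry s g d H n hn hds hdg hdH (hd.trans hdH) hs hg a b l.1 l.2 (l.1.2.le.trans ht3)
      (by
        have h1 : b ≤ 4 * n ^ 2 := by omega
        have h2 : (l.2 : ℕ) ≤ 2 * n := by have := l.2.2; omega
        calc _ ≤ 4 * n ^ 2 * (2 * n) := Nat.mul_le_mul h1 h2
          _ = 8 * n ^ 3 := by ring)
      (by omega) (by omega)
  set V := gsV s g (fun l => (x l : K)) a b with hV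
  set α : K := (d : K) ^ (9 * n ^ 3) * V with hα
  have hdK : (d : K) ≠ 0 := by
    have : d ≠ 0 := by omega
    exact_mod_cast this
  have hα0 : α ≠ 0 := mul_ne_zero (pow_ne_zero _ hdK) hne
  have hαs : α = ∑ l, (x l : K) *
      ((d : K) ^ (9 * n ^ 3) * (((a : K) + b * s) ^ (l.1 : ℕ) * g ^ (b * (l.2 : ℕ)))) := by
    rw [hα, hV, gsV, Finset.mul_sum]
    refine Finset.sum_congr rfl fun l _ => ?_
    ring
  have hαint : IsIntegral ℤ α := by
    rw [hαs]
    exact IsIntegral.sum _ fun l _ => (RingOfIntegers.isIntegral_coe (x l)).mul (key l).1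
  have hαhouse : house α ≤ Q ^ (44 * n ^ 3) := by
    rw [hαs]
    refine (house_sum_le_sum_house _ _).trans ?_
    calc _ ≤ ∑ _l : Fin (t ^ 3) × Fin (2 * t), Q ^ (22 * n ^ 3) * Q ^ (18 * n ^ 3) := by
          refine Finset.sum_le_sum fun l _ => (house_mul_le _ _).trans ?_
          gcongr
          · exact house_nonneg _
          · exact hx l
          · refine (key l).2.trans ?_
            rw [hQ]
            gcongr
            linarith
      _ = ((t ^ 3 : ℕ) : ℝ) * (2 * t : ℕ) * (Q ^ (22 * n ^ 3) * Q ^ (18 * n ^ 3)) := by simp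
      _ ≤ Q ^ (4 * n ^ 3) * (Q ^ (22 * n ^ 3) * Q ^ (18 * n ^ 3)) := by gcongr
      _ = _ := by rw [← pow_add, ← pow_add]; congr 1; ring
  -- the analytic function
  set F : ℂ → ℂ := fun z => ∑ l, σ (x l : K) * (z ^ (l.1 : ℕ) *
    Complex.exp (2 * (Real.pi : ℂ) * Complex.I * z) ^ (l.2 : ℕ)) with hF
  have hFd : Differentiable ℂ F := by rw [hF]; fun_prop
  have hFV : ∀ a b : ℕ, F (a + b * σ s) = σ (gsV s g (fun l => (x l : K)) a b) := by
    intro a b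
    have e : Complex.exp (2 * (Real.pi : ℂ) * Complex.I * (a + b * σ s)) = σ g ^ b := by
      rw [mul_add, Complex.exp_add, ← hexp, ← Complex.exp_nat_mul]
      rw [show 2 * (Real.pi : ℂ) * Complex.I * a = a * (2 * (Real.pi : ℂ) * Complex.I) by ring,
        Complex.exp_nat_mul_two_pi_mul_I, one_mul]
      congr 1; ring
    simp only [hF, gsV, e, map_sum, map_mul, map_pow, map_add, map_natCast, pow_mul]
  have hσs : ‖σ s‖ ≤ house s := norm_embedding_le_house s σ
  set r : ℝ := 4 * n ^ 2 * H with hr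
  have hr1 : 1 ≤ r := by
    have : (1 : ℝ) ≤ n ^ 2 := one_le_pow₀ hn1
    nlinarith
  have hpt : ∀ a b : ℕ, a ≤ 4 * n ^ 2 → b ≤ 4 * n ^ 2 → ‖(a : ℂ) + b * σ s‖ ≤ r := by
    intro a b ha hb
    have ha' : (a : ℝ) ≤ 4 * n ^ 2 := by exact_mod_cast ha
    have hb' : (b : ℝ) ≤ 4 * n ^ 2 := by exact_mod_cast hb
    calc _ ≤ ‖(a : ℂ)‖ + ‖(b : ℂ) * σ s‖ := norm_add_le _ _
      _ = a + b * ‖σ s‖ := by simp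
      _ ≤ 4 * n ^ 2 + 4 * n ^ 2 * house s := by gcongr
      _ = 4 * n ^ 2 * (1 + house s) := by ring
      _ ≤ _ := by rw [hr]; gcongr
  let S : Finset ℂ := (Finset.univ : Finset (Fin (n ^ 2) × Fin (n ^ 2))).image
    (fun k => ((k.1 : ℕ) : ℂ) + (k.2 : ℕ) * σ s)
  have hScard : S.card = n ^ 4 := by
    rw [Finset.card_image_of_injective]
    · simp; ring
    · rintro ⟨a, b⟩ ⟨a', b'⟩ h
      have h' : σ (((a : ℕ) : K) + (b : ℕ) * s) = σ (((a' : ℕ) : K) + (b' : ℕ) * s) := by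
        simpa using h
      obtain ⟨h1, h2⟩ := hinj _ _ _ _ (σ.injective h')
      exact Prod.ext (Fin.ext h1) (Fin.ext h2)
  have hSch := gs_schwarz S F hFd
    (by
      intro z hz
      obtain ⟨k, -, rfl⟩ := Finset.mem_image.1 hz
      rw [hFV, hv _ _ k.1.2 k.2.2, map_zero])
    r _ (by linarith)
    (by
      intro z hz
      obtain ⟨k, -, rfl⟩ := Finset.mem_image.1 hz
      exact hpt _ _ (by have := k.1.2; omega) (by have := k.2.2; omega))
    (fun z hz => gs_F_bound (fun l => σ (x l : K)) (Q ^ (22 * n ^ 3)) (5 * r)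
      (fun l => (norm_embedding_le_house _ σ).trans (hx l)) (by linarith) z hz.le)
    (a + b * σ s) (hpt a b (by omega) (by omega))
  rw [hFV, hScard, ← hV] at hSch
  have hR : (5 * r) ^ (t ^ 3) ≤ Q ^ (2 * n ^ 3) := by
    calc (5 * r) ^ (t ^ 3) ≤ (5 * r) ^ (n ^ 3) := pow_le_pow_right₀ (by linarith) ht3
      _ ≤ (Q ^ 2) ^ (n ^ 3) := by
        gcongr
        rw [hr, hQ, mul_pow]
        have : 20 * (H : ℝ) ≤ C ^ 2 := by nlinarith
        calc 5 * (4 * (n : ℝ) ^ 2 * H) = (20 * H) * n ^ 2 := by ring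
          _ ≤ _ := by gcongr
      _ = _ := by rw [← pow_mul]
  have hE : Real.exp (2 * Real.pi * (5 * r)) ^ (2 * t) ≤ Q ^ (n ^ 3) := by
    calc Real.exp (2 * Real.pi * (5 * r)) ^ (2 * t) ≤ Real.exp (2 * Real.pi * (5 * r)) ^ (2 * n) := by
          apply pow_le_pow_right₀
          · exact Real.one_le_exp (by have := Real.pi_pos; positivity)
          · omega
      _ = Real.exp (80 * Real.pi * H) ^ (n ^ 3) := by
          rw [← Real.exp_nat_mul, ← Real.exp_nat_mul, hr]
          congr 1
          push_cast
          ring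
      _ ≤ _ := by
          gcongr
          exact hCe.trans hQC
  have hσα : ‖σ α‖ ≤ Q ^ (44 * n ^ 3) / 2 ^ (n ^ 4) := by
    rw [hα, map_mul, map_pow, map_natCast, norm_mul, norm_pow, Complex.norm_natCast]
    calc _ ≤ Q ^ (9 * n ^ 3) * (Q ^ (4 * n ^ 3) * (Q ^ (22 * n ^ 3) * (Q ^ (2 * n ^ 3) * Q ^ (n ^ 3)))
            / 2 ^ (n ^ 4)) := by
          gcongr
          · have : (d : ℝ) ≤ H := by exact_mod_cast hdH
            linarith
          · refine hSch.trans ?_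
            gcongr
      _ = Q ^ (38 * n ^ 3) / 2 ^ (n ^ 4) := by
          rw [← pow_add, ← pow_add, ← pow_add, ← mul_div_assoc, ← pow_add]
          congr 2
          ring
      _ ≤ _ := by
          gcongr
          norm_num
  -- the contradiction
  have hnorm := norm_norm_le_norm_mul_house_pow α σ
  have hnorm1 : 1 ≤ ‖Algebra.norm ℚ α‖ := by
    have hIntegral := Algebra.isIntegral_norm ℚ hαint
    obtain ⟨m, hm⟩ := IsIntegrallyClosed.isIntegral_iff.1 hIntegral
    have hm0 : m ≠ 0 := by
      rintro rfl
      rw [map_zero] at hm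
      exact hα0 (Algebra.norm_eq_zero_iff.1 hm.symm)
    rw [← hm]
    simp only [eq_intCast, Int.norm_cast_rat]
    rw [Int.norm_eq_abs]
    exact_mod_cast Int.one_le_abs hm0
  set h := Module.finrank ℚ K
  have hh : 0 < h := Module.finrank_pos
  have hfin : 1 ≤ Q ^ (44 * h * n ^ 3) / 2 ^ (n ^ 4) := by
    calc (1 : ℝ) ≤ ‖σ α‖ * house α ^ (h - 1) := hnorm1.trans hnorm
      _ ≤ Q ^ (44 * n ^ 3) / 2 ^ (n ^ 4) * (Q ^ (44 * n ^ 3)) ^ (h - 1) := by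
          gcongr
          · exact pow_nonneg (house_nonneg _) _
          · exact house_nonneg _
      _ = _ := by
          rw [← pow_mul, div_mul_eq_mul_div, ← pow_add]
          congr 2
          obtain ⟨k, hk⟩ : ∃ k, h = k + 1 := ⟨h - 1, by omega⟩
          rw [hk]
          simp only [Nat.add_sub_cancel]
          ring
  rw [le_div_iff₀ (by positivity), one_mul, show n ^ 4 = n * n ^ 3 by ring, pow_mul, pow_mul Q]
    at hfin
  exact absurd (pow_lt_pow_left₀ hlt (by positivity) (by omega : n ^ 3 ≠ 0)) (not_lt.2 hfin)

lemma gs_core {K : Type*} [Field K] [NumberField K] (σ : K →+* ℂ) (s g : K)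
    (hexp : Complex.exp (2 * (Real.pi : ℂ) * Complex.I * σ s) = σ g)
    (hirr : ∀ b : ℕ, 0 < b → ∀ a : ℤ, (b : K) * s ≠ a) : False := by
  have hIntegral : ∀ y : K, ∃ m : ℕ, 1 ≤ m ∧ IsIntegral ℤ ((m : K) * y) := by
    intro y
    obtain ⟨m, hm0, hm⟩ := IsAlgebraic.exists_integral_multiple
      ((IsFractionRing.isAlgebraic_iff ℤ ℚ K).2 (Algebra.IsAlgebraic.isAlgebraic (R := ℚ) y))
    refine ⟨m.natAbs, by omega, ?_⟩
    rcases Int.natAbs_eq m with h | h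
    · rw [h] at hm; simpa using hm
    · rw [h] at hm; simpa using hm.neg
  obtain ⟨d1, hd1, hds⟩ := hIntegral s
  obtain ⟨d2, hd2, hdg⟩ := hIntegral g
  have hnat : ∀ m : ℕ, IsIntegral ℤ (m : K) := fun m => by
    simpa using isIntegral_algebraMap (R := ℤ) (A := K) (x := (m : ℤ))
  have hds' : IsIntegral ℤ (((d1 * d2 : ℕ) : K) * s) := by
    rw [show ((d1 * d2 : ℕ) : K) * s = d2 * (d1 * s) by push_cast; ring]
    exact (hnat d2).mul hds
  have hdg' : IsIntegral ℤ (((d1 * d2 : ℕ) : K) * g) := by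
    rw [show ((d1 * d2 : ℕ) : K) * g = d1 * (d2 * g) by push_cast; ring]
    exact (hnat d1).mul hdg
  have hd : 1 ≤ d1 * d2 := Nat.mul_pos hd1 hd2
  set d := d1 * d2
  obtain ⟨H1, hH1⟩ := exists_nat_ge (1 + house s)
  obtain ⟨H2, hH2⟩ := exists_nat_ge (1 + house g)
  obtain ⟨H, hHd, hHs, hHg⟩ : ∃ H : ℕ, d ≤ H ∧ 1 + house s ≤ H ∧ 1 + house g ≤ H :=
    ⟨d + H1 + H2, by omega, by push_cast; linarith [Nat.cast_nonneg (α := ℝ) H2, Nat.cast_nonneg (α := ℝ) d],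
      by push_cast; linarith [Nat.cast_nonneg (α := ℝ) H1, Nat.cast_nonneg (α := ℝ) d]⟩
  obtain ⟨C0, hC0, hsieg⟩ := gs_siegel s g d H hds' hdg' hd hHd hHs hHg
  set C : ℝ := C0 + 20 * H + Real.exp (80 * Real.pi * H) with hC
  have hH0 : (0 : ℝ) ≤ H := Nat.cast_nonneg _
  have hC00 : (0 : ℝ) ≤ C0 := Nat.cast_nonneg _
  have hE1 : 1 ≤ Real.exp (80 * Real.pi * H) := Real.one_le_exp (by have := Real.pi_pos; positivity)
  obtain ⟨t, ht, hgrow⟩ := gs_growth C (44 * Module.finrank ℚ K)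
  obtain ⟨x, hx0, hxv, hxb⟩ := hsieg t ht
  have hinj : ∀ a b a' b' : ℕ, (a : K) + b * s = a' + b' * s → a = a' ∧ b = b' := by
    have aux : ∀ a b a' b' : ℕ, b < b' → (a : K) + b * s ≠ a' + b' * s := by
      intro a b a' b' hb h
      apply hirr (b' - b) (by omega) ((a : ℤ) - a')
      push_cast [Nat.cast_sub hb.le]
      linear_combination -h
    intro a b a' b' h
    rcases lt_trichotomy b b' with hb | hb | hb
    · exact absurd h (aux _ _ _ _ hb)
    · subst hb
      exact ⟨by simpa using h, rfl⟩
    · exact absurd h.symm (aux _ _ _ _ hb)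
  have hall : ∀ n, t ≤ n → ∀ a b, a < n ^ 2 → b < n ^ 2 →
      gsV s g (fun l => (x l : K)) a b = 0 := by
    intro n hn
    induction n, hn using Nat.le_induction with
    | base => exact hxv
    | succ n hn ih =>
      refine gs_step σ s g d H hexp hinj hds' hdg' hd hHd hHs hHg C (by linarith) (by linarith)
        t n ht hn x ?_ ih (hgrow n hn)
      intro l
      have hn1 : (1 : ℝ) ≤ n := by exact_mod_cast ht.trans hn
      have hCC : (C0 : ℝ) ≤ C := by linarith
      have htn : (t : ℝ) ≤ n := by exact_mod_cast hn
      calc _ ≤ _ := hxb l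
        _ ≤ (C * n) ^ (22 * t ^ 3) := by gcongr
        _ ≤ _ := by
          apply pow_le_pow_right₀
          · nlinarith
          · gcongr
  have hg : Function.Injective (fun b : ℕ => g ^ b) := by
    have hg0 : g ≠ 0 := by
      rintro rfl
      rw [map_zero] at hexp
      exact Complex.exp_ne_zero _ hexp
    have aux : ∀ b : ℕ, 0 < b → g ^ b ≠ 1 := by
      intro b hb h
      have h1 : σ g ^ b = 1 := by rw [← map_pow, h, map_one]
      rw [← hexp, ← Complex.exp_nat_mul, Complex.exp_eq_one_iff] at h1
      obtain ⟨m, hm⟩ := h1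
      apply hirr b hb m
      apply σ.injective
      have hpi := Complex.two_pi_I_ne_zero
      simp only [map_mul, map_natCast, map_intCast]
      apply mul_right_cancel₀ hpi
      linear_combination hm
    have aux2 : ∀ b b' : ℕ, b < b' → g ^ b ≠ g ^ b' := by
      intro b b' hb h
      obtain ⟨k, rfl⟩ := Nat.exists_eq_add_of_lt hb
      apply aux (k + 1) (by omega)
      rw [add_assoc, pow_add] at h
      exact mul_left_cancel₀ (pow_ne_zero b hg0) (by rw [← h, mul_one])
    intro b b' h
    rcases lt_trichotomy b b' with hb | hb | hb
    · exact absurd h (aux2 _ _ hb)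
    · exact hb
    · exact absurd h.symm (aux2 _ _ hb)
  have hz : (fun l => (x l : K)) = 0 := by
    apply gs_nonvanish s g _ hg
    intro a b
    have hsq : t + a + b + 1 ≤ (t + a + b + 1) ^ 2 := Nat.le_self_pow (by norm_num) _
    exact hall (t + a + b + 1) (by omega) a b (by omega) (by omega)
  apply hx0
  ext l
  exact congrFun hz l

/-- Gelfond–Schneider consequence: if `s` and `e^{2πis}` are both
algebraic, then `s` is rational and `e^{2πis}` is a root of unity. -/
theorem rational_of_algebraic_self_and_exp
    (s : ℂ) (hs : IsAlgebraic ℚ s)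
    (he : IsAlgebraic ℚ (Complex.exp (2 * (Real.pi : ℂ) * Complex.I * s))) :
    (∃ q : ℚ, (q : ℂ) = s) ∧
    ∃ m : ℕ, 0 < m ∧ (Complex.exp (2 * (Real.pi : ℂ) * Complex.I * s)) ^ m = 1 := by
  obtain ⟨b, hb, a, hab⟩ : ∃ b : ℕ, 0 < b ∧ ∃ a : ℤ, (b : ℂ) * s = a := by
    by_contra hcon
    push Not at hcon
    set γ := Complex.exp (2 * (Real.pi : ℂ) * Complex.I * s) with hγ
    let K := IntermediateField.adjoin ℚ ({s, γ} : Set ℂ)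
    have hfd : FiniteDimensional ℚ K := by
      apply IntermediateField.finiteDimensional_adjoin
      rintro y (rfl | rfl)
      · exact hs.isIntegral
      · exact he.isIntegral
    have : NumberField K := { to_charZero := inferInstance, to_finiteDimensional := hfd }
    have hsK : s ∈ K := IntermediateField.subset_adjoin ℚ _ (by simp)
    have hgK : γ ∈ K := IntermediateField.subset_adjoin ℚ _ (by simp)
    refine gs_core (K := K) (algebraMap K ℂ) ⟨s, hsK⟩ ⟨γ, hgK⟩ hγ.symm ?_
    intro b hb a h
    apply hcon b hb a
    have := congrArg (algebraMap K ℂ) h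
    rw [map_mul, map_natCast, map_intCast] at this
    exact this
  have hb0 : (b : ℂ) ≠ 0 := by exact_mod_cast hb.ne'
  refine ⟨⟨(a : ℚ) / b, ?_⟩, b, hb, ?_⟩
  · push_cast
    rw [← hab]; field_simp
  · rw [← Complex.exp_nat_mul, Complex.exp_eq_one_iff]
    exact ⟨a, by linear_combination (2 * (Real.pi : ℂ) * Complex.I) * hab⟩
end
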